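/- Let f : D ⊆ E → F be an analytic map between real Banach spaces and let ζ ∈ D be a nondegenerate zero of f, i.e. f(ζ) = 0 and Df(ζ) is invertible. Assume the open ball B = B(ζ, (3−√7)/(2·γ(f,ζ))) is contained in D. Then every x₀ ∈ B is an approximate zero of the first kind associated to ζ: the Newton sequence x_{i+1} = N(f, x_i) starting at x₀ is well-defined (each x_i ∈ D and Df(x_i) is invertible) and satisfies ‖x_i − ζ‖ ≤ 2^{1−2^i}·‖x₀ − ζ‖ for all i ≥ 0. -/

import Mathlib

open Filter Metric

/-- The k-th term whose supremum over `k ≥ 2` defines Smale's gamma invariant: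
`‖(1/k!) · Df(x)⁻¹ ∘ D^k f(x)‖^(1/(k-1))`, where `dinv` plays the role of `Df(x)⁻¹`. -/
noncomputable def gammaTerm {E F : Type*} [NormedAddCommGroup E] [NormedSpace ℝ E]
    [NormedAddCommGroup F] [NormedSpace ℝ F]
    (f : E → F) (dinv : F →L[ℝ] E) (x : E) (k : ℕ) : ℝ :=
  (‖dinv.compContinuousMultilinearMap (iteratedFDeriv ℝ k f x)‖ / (Nat.factorial k : ℝ)) ^
    ((1 : ℝ) / ((k : ℝ) - 1))

/-- The set of values `gammaTerm f dinv x k` for `k ≥ 2`. -/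
noncomputable def gammaSet {E F : Type*} [NormedAddCommGroup E] [NormedSpace ℝ E]
    [NormedAddCommGroup F] [NormedSpace ℝ F]
    (f : E → F) (dinv : F →L[ℝ] E) (x : E) : Set ℝ :=
  {g : ℝ | ∃ k : ℕ, 2 ≤ k ∧ g = gammaTerm f dinv x k}

/-- Smale's gamma invariant `γ(f,x) = sup_{k ≥ 2} ‖(1/k!)·Df(x)⁻¹ ∘ D^k f(x)‖^(1/(k-1))`. -/
noncomputable def smaleGamma {E F : Type*} [NormedAddCommGroup E] [NormedSpace ℝ E]
    [NormedAddCommGroup F] [NormedSpace ℝ F]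
    (f : E → F) (dinv : F →L[ℝ] E) (x : E) : ℝ :=
  sSup (gammaSet f dinv x)

open scoped Topology

theorem derivSeries_norm_le {E F : Type*} [NormedAddCommGroup E] [NormedSpace ℝ E]
    [NormedAddCommGroup F] [NormedSpace ℝ F] (q : FormalMultilinearSeries ℝ E F) (n : ℕ) :
    ‖q.derivSeries n‖ ≤ (n + 1) * ‖q (n + 1)‖ := by
  have h1 : ‖q.derivSeries n‖ ≤ ‖q.changeOriginSeries 1 n‖ := by
    refine ContinuousMultilinearMap.opNorm_le_bound (ContinuousMultilinearMap.opNorm_nonneg _) fun m => ?_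
    simp only [FormalMultilinearSeries.derivSeries,
      ContinuousLinearMap.compFormalMultilinearSeries_apply,
      ContinuousLinearMap.compContinuousMultilinearMap_coe, Function.comp_apply,
      ContinuousLinearEquiv.coe_coe, LinearIsometryEquiv.coe_toContinuousLinearEquiv,
      LinearIsometryEquiv.norm_map]
    exact ContinuousMultilinearMap.le_opNorm _ _
  have h2 : ‖q.changeOriginSeries 1 n‖ ≤ (n + 1) * ‖q (1 + n)‖ := by
    have := q.nnnorm_changeOriginSeries_le_tsum 1 n
    rw [tsum_fintype, Finset.sum_const, Finset.card_univ, Fintype.card_finset_len,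
      Fintype.card_fin, ← NNReal.coe_le_coe] at this
    have e : (1 + n).choose n = n + 1 := by rw [add_comm, Nat.choose_succ_self_right]
    rw [e] at this
    simpa using this
  rw [add_comm 1 n] at h2
  exact h1.trans h2

theorem newton_est {E : Type*} [NormedAddCommGroup E] [NormedSpace ℝ E] [CompleteSpace E]
    (g : E → E) (q : FormalMultilinearSeries ℝ E E) (ζ : E) (r : ENNReal)
    (hg : HasFPowerSeriesOnBall g q ζ r) (h0 : g ζ = 0)
    (h1 : fderiv ℝ g ζ = ContinuousLinearMap.id ℝ E) (γ : ℝ) (hγ : 0 ≤ γ)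
    (hq : ∀ k, ‖q (k + 2)‖ ≤ γ ^ (k + 1)) (h : E) (hr : h ∈ eball (0 : E) r)
    (hu : ‖h‖ * γ < 1) :
    ‖fderiv ℝ g (ζ + h) - ContinuousLinearMap.id ℝ E‖ ≤ 1 / (1 - ‖h‖ * γ) ^ 2 - 1 ∧
    ‖fderiv ℝ g (ζ + h) h - g (ζ + h)‖ ≤ ‖h‖ * (‖h‖ * γ / (1 - ‖h‖ * γ) ^ 2) := by
  have hu0 : 0 ≤ ‖h‖ * γ := by positivity
  have hun : ‖‖h‖ * γ‖ < 1 := by rwa [Real.norm_of_nonneg hu0]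
  have hD := hg.fderiv.hasSum hr
  have hS := hg.hasSum hr
  have hG := hasSum_choose_mul_geometric_of_norm_lt_one 1 hun
  constructor
  · have e := (hasSum_nat_add_iff' 1).2 hD
    have eG := (hasSum_nat_add_iff' 1).2 hG
    simp only [Finset.sum_range_one] at e eG
    rw [hg.fderiv.coeff_zero, h1] at e
    have key := e.norm_le_of_bounded eG (fun n => by
      refine (ContinuousMultilinearMap.le_opNorm _ _).trans ?_
      rw [Finset.prod_const, Finset.card_univ, Fintype.card_fin]
      refine (mul_le_mul_of_nonneg_right ((derivSeries_norm_le q (n+1)).trans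
        (mul_le_mul_of_nonneg_left (hq n) (by positivity))) (by positivity)).trans_eq ?_
      rw [Nat.choose_one_right]; push_cast; rw [mul_pow]; ring)
    simpa using key
  · have hDh := (ContinuousLinearMap.apply ℝ E h).hasSum hD
    simp only [ContinuousLinearMap.apply_apply, FormalMultilinearSeries.derivSeries_apply_diag]
      at hDh
    have e := (hasSum_nat_add_iff' 1).2 hS
    simp only [Finset.sum_range_one] at e
    rw [hg.coeff_zero, h0, sub_zero] at e
    have hd := hDh.sub e
    have hG2 := (hasSum_coe_mul_geometric_of_norm_lt_one hun).mul_left ‖h‖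
    refine hd.norm_le_of_bounded hG2 (fun n => ?_)
    have e2 : (n + 1) • q (n + 1) (fun _ => h) - q (n + 1) (fun _ => h)
      = n • q (n + 1) (fun _ => h) := by rw [add_smul, one_smul, add_sub_cancel_right]
    rw [e2]
    rcases n with _ | n
    · simp
    · rw [← Nat.cast_smul_eq_nsmul ℝ, norm_smul]
      have := (q (n + 1 + 1)).le_opNorm (fun _ => h)
      rw [Finset.prod_const, Finset.card_univ, Fintype.card_fin] at this
      rw [Real.norm_of_nonneg (by positivity)]
      refine (mul_le_mul_of_nonneg_left (this.trans
        (mul_le_mul_of_nonneg_right (hq n) (by positivity))) (by positivity)).trans_eq ?_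
      rw [mul_pow]; ring

theorem norm_iteratedFDeriv_le_coeff {E F : Type*} [NormedAddCommGroup E] [NormedSpace ℝ E]
    [NormedAddCommGroup F] [NormedSpace ℝ F] [CompleteSpace F]
    (f : E → F) (p : FormalMultilinearSeries ℝ E F) (ζ : E) (r : ENNReal)
    (hf : HasFPowerSeriesOnBall f p ζ r) (n : ℕ) :
    ‖iteratedFDeriv ℝ n f ζ‖ ≤ (n.factorial : ℝ) * ‖p n‖ := by
  refine ContinuousMultilinearMap.opNorm_le_bound (by positivity) fun v => ?_
  rw [hf.iteratedFDeriv_eq_sum_of_completeSpace]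
  refine (norm_sum_le_of_le (n := fun _ => ‖p n‖ * ∏ i, ‖v i‖) _ fun σ _ => ?_).trans_eq ?_
  · refine ((p n).le_opNorm _).trans_eq ?_
    rw [Equiv.prod_comp σ (fun i => ‖v i‖)]
  · rw [Finset.sum_const, Finset.card_univ, Fintype.card_perm, Fintype.card_fin, nsmul_eq_mul]
    ring

theorem gammaSet_bdd {E F : Type*} [NormedAddCommGroup E] [NormedSpace ℝ E]
    [NormedAddCommGroup F] [NormedSpace ℝ F] [CompleteSpace F]
    (f : E → F) (B : F →L[ℝ] E) (ζ : E) (hf : AnalyticAt ℝ f ζ) : BddAbove (gammaSet f B ζ) := by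
  obtain ⟨p, r, hp⟩ := hf
  obtain ⟨s, hs0, hsr⟩ := ENNReal.lt_iff_exists_nnreal_btwn.1 (hp.r_pos.trans_le hp.r_le)
  obtain ⟨C, hC, hpC⟩ := p.norm_le_div_pow_of_pos_of_lt_radius (by simpa using hs0) hsr
  have hs : (0:ℝ) < s := by simpa using hs0
  set M : ℝ := max 1 (‖B‖ * C / s) with hM
  set t : ℝ := max 1 (s:ℝ)⁻¹ with ht
  have hM1 : 1 ≤ M := le_max_left _ _
  have ht1 : 1 ≤ t := le_max_left _ _
  refine ⟨M * t, ?_⟩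
  rintro _ ⟨k, hk, rfl⟩
  obtain ⟨n, rfl⟩ := Nat.exists_eq_add_of_le hk
  have hb : ‖B.compContinuousMultilinearMap (iteratedFDeriv ℝ (2 + n) f ζ)‖ /
      ((2 + n).factorial : ℝ) ≤ (M * t) ^ (n + 1) := by
    rw [div_le_iff₀ (by positivity)]
    calc _ ≤ ‖B‖ * ‖iteratedFDeriv ℝ (2 + n) f ζ‖ :=
          ContinuousLinearMap.norm_compContinuousMultilinearMap_le _ _
      _ ≤ ‖B‖ * (((2 + n).factorial : ℝ) * (C / s ^ (2 + n))) := by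
          gcongr
          refine (norm_iteratedFDeriv_le_coeff f p ζ r hp _).trans ?_
          gcongr
          exact hpC _
      _ = (‖B‖ * C / s) * ((s:ℝ)⁻¹) ^ (n + 1) * ((2 + n).factorial : ℝ) := by
          have e : (s:ℝ) ^ (2 + n) = s ^ (n + 1) * s := by ring
          rw [e, inv_pow]; field_simp
      _ ≤ M * t ^ (n + 1) * ((2 + n).factorial : ℝ) := by
          gcongr
          · exact le_max_right _ _
          · exact le_max_right _ _
      _ ≤ (M * t) ^ (n + 1) * ((2 + n).factorial : ℝ) := by
          rw [mul_pow]
          gcongr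
          exact le_self_pow₀ hM1 (by simp)
  unfold gammaTerm
  refine (Real.rpow_le_rpow (by positivity) hb ?_).trans_eq ?_
  · push_cast; apply div_nonneg zero_le_one; linarith [(Nat.cast_nonneg n : (0:ℝ) ≤ n)]
  · have : (1:ℝ) / (((2 + n : ℕ):ℝ) - 1) = ((n + 1 : ℕ) : ℝ)⁻¹ := by
      push_cast; rw [one_div]; congr 1; ring
    rw [this, Real.pow_rpow_inv_natCast (by positivity) (by simp)]

theorem gamma_nonneg {E F : Type*} [NormedAddCommGroup E] [NormedSpace ℝ E]
    [NormedAddCommGroup F] [NormedSpace ℝ F]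
    (f : E → F) (B : F →L[ℝ] E) (ζ : E) : 0 ≤ smaleGamma f B ζ := by
  apply Real.sSup_nonneg
  rintro _ ⟨k, hk, rfl⟩
  unfold gammaTerm
  positivity

theorem gamma_bound {E F : Type*} [NormedAddCommGroup E] [NormedSpace ℝ E]
    [NormedAddCommGroup F] [NormedSpace ℝ F] [CompleteSpace F]
    (f : E → F) (B : F →L[ℝ] E) (ζ : E) (hf : AnalyticAt ℝ f ζ) (n : ℕ) :
    ‖B.compContinuousMultilinearMap (iteratedFDeriv ℝ (n + 2) f ζ)‖ / ((n + 2).factorial : ℝ)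
      ≤ smaleGamma f B ζ ^ (n + 1) := by
  have h := le_csSup (gammaSet_bdd f B ζ hf) ⟨n + 2, by omega, rfl⟩
  change gammaTerm f B ζ (n + 2) ≤ smaleGamma f B ζ at h
  unfold gammaTerm at h
  have : (1:ℝ) / (((n + 2 : ℕ):ℝ) - 1) = ((n + 1 : ℕ) : ℝ)⁻¹ := by
    push_cast; rw [one_div]; congr 1; ring
  rw [this] at h
  have h2 := pow_le_pow_left₀ (by positivity) h (n + 1)
  rwa [Real.rpow_inv_natCast_pow (by positivity) (by simp)] at h2

/-- The Taylor series at `ζ`, composed with `B`. -/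
noncomputable def taylorQ {E F : Type*} [NormedAddCommGroup E] [NormedSpace ℝ E]
    [NormedAddCommGroup F] [NormedSpace ℝ F]
    (f : E → F) (B : F →L[ℝ] E) (ζ : E) : FormalMultilinearSeries ℝ E E := fun k =>
  ((k.factorial : ℝ)⁻¹) • B.compContinuousMultilinearMap (iteratedFDeriv ℝ k f ζ)

theorem taylorQ_bound {E F : Type*} [NormedAddCommGroup E] [NormedSpace ℝ E]
    [NormedAddCommGroup F] [NormedSpace ℝ F] [CompleteSpace F]
    (f : E → F) (B : F →L[ℝ] E) (ζ : E) (hf : AnalyticAt ℝ f ζ) (n : ℕ) :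
    ‖taylorQ f B ζ (n + 2)‖ ≤ smaleGamma f B ζ ^ (n + 1) := by
  refine le_trans (le_of_eq ?_) (gamma_bound f B ζ hf n)
  rw [taylorQ, norm_smul, Real.norm_of_nonneg (by positivity), div_eq_inv_mul]

theorem taylorQ_radius {E F : Type*} [NormedAddCommGroup E] [NormedSpace ℝ E]
    [NormedAddCommGroup F] [NormedSpace ℝ F] [CompleteSpace F]
    (f : E → F) (B : F →L[ℝ] E) (ζ : E) (hf : AnalyticAt ℝ f ζ) (r : NNReal)
    (hr : r * smaleGamma f B ζ ≤ 1) : (r : ENNReal) ≤ (taylorQ f B ζ).radius := by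
  have hγ := gamma_nonneg f B ζ
  refine FormalMultilinearSeries.le_radius_of_bound _
    (‖taylorQ f B ζ 0‖ + ‖taylorQ f B ζ 1‖ * r + r) fun n => ?_
  have a0 : 0 ≤ ‖taylorQ f B ζ 0‖ := norm_nonneg _
  have a1 : 0 ≤ ‖taylorQ f B ζ 1‖ * r := by positivity
  have a2 : (0:ℝ) ≤ r := r.2
  rcases n with _ | _ | n
  · rw [pow_zero, mul_one]; linarith
  · simp only [zero_add, pow_one]; linarith
  · have := mul_le_mul_of_nonneg_right (taylorQ_bound f B ζ hf n) (by positivity : (0:ℝ) ≤ r ^ (n+2))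
    have e : smaleGamma f B ζ ^ (n + 1) * (r:ℝ) ^ (n + 2)
       = (r * smaleGamma f B ζ) ^ (n + 1) * r := by rw [mul_pow]; ring
    rw [e] at this
    have h1 : ((r:ℝ) * smaleGamma f B ζ) ^ (n + 1) ≤ 1 := pow_le_one₀ (by positivity) hr
    have := mul_le_mul_of_nonneg_right h1 a2
    change ‖taylorQ f B ζ (n + 2)‖ * (r:ℝ) ^ (n + 2) ≤ _
    linarith

theorem taylorQ_series {E F : Type*} [NormedAddCommGroup E] [NormedSpace ℝ E] [CompleteSpace E]
    [NormedAddCommGroup F] [NormedSpace ℝ F] [CompleteSpace F]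
    (D : Set E) (f : E → F) (hf : AnalyticOnNhd ℝ f D)
    (B : F →L[ℝ] E) (ζ : E) (hζ : ζ ∈ D) (r : NNReal) (hr0 : 0 < r)
    (hr : r * smaleGamma f B ζ ≤ 1) (hD : ball ζ r ⊆ D) :
    HasFPowerSeriesOnBall (fun x => B (f x)) (taylorQ f B ζ) ζ r := by
  have hrad := taylorQ_radius f B ζ (hf ζ hζ) r hr
  have hr0' : (0 : ENNReal) < r := by simpa using hr0
  have hQ : HasFPowerSeriesOnBall (fun x => (taylorQ f B ζ).sum (x - ζ)) (taylorQ f B ζ) ζ r := by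
    simpa using (((taylorQ f B ζ).hasFPowerSeriesOnBall (hr0'.trans_le hrad)).mono hr0' hrad).comp_sub ζ
  refine hQ.congr ?_
  have hev : (fun x => (taylorQ f B ζ).sum (x - ζ)) =ᶠ[𝓝 ζ] fun x => B (f x) := by
    obtain ⟨p, s, hp⟩ := hf ζ hζ
    filter_upwards [Metric.eball_mem_nhds ζ hp.r_pos] with x hx
    have hx' : x - ζ ∈ eball (0 : E) s := by
      simpa [mem_eball, edist_eq_enorm_sub] using hx
    have := B.hasSum (hp.hasSum_iteratedFDeriv hx')
    rw [add_sub_cancel] at this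
    rw [← this.tsum_eq]
    simp [FormalMultilinearSeries.sum, taylorQ]
  have := AnalyticOnNhd.eqOn_of_preconnected_of_eventuallyEq (𝕜 := ℝ) (U := eball ζ r)
    hQ.analyticOnNhd (g := fun x => B (f x)) (fun x hx => ?_) ?_ (mem_eball_self hr0') hev
  · exact this
  · rw [Metric.eball_coe] at hx
    exact (B.analyticAt _).comp (hf x (hD hx))
  · rw [Metric.eball_coe]
    exact (convex_ball _ _).isPreconnected

theorem newton_one {E F : Type*} [NormedAddCommGroup E] [NormedSpace ℝ E] [CompleteSpace E]
    [NormedAddCommGroup F] [NormedSpace ℝ F] [CompleteSpace F]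
    (D : Set E) (f : E → F) (hf : AnalyticOnNhd ℝ f D)
    (ζ : E) (hζ : ζ ∈ D) (hfζ : f ζ = 0)
    (A : E ≃L[ℝ] F) (hA : (A : E →L[ℝ] F) = fderiv ℝ f ζ) (c : ℝ)
    (hc : ∀ u : ℝ, 0 ≤ u → u < c → u < 1 ∧ 0 < 1 - 4 * u + 2 * u ^ 2)
    (hball : ∀ x : E,
      ‖x - ζ‖ * smaleGamma f (A.symm : F →L[ℝ] E) ζ < c → x ∈ D)
    (x : E) (hx : ‖x - ζ‖ * smaleGamma f (A.symm : F →L[ℝ] E) ζ < c) :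
    ∃ A' : E ≃L[ℝ] F, (A' : E →L[ℝ] F) = fderiv ℝ f x ∧
      ∀ u : ℝ, u = ‖x - ζ‖ * smaleGamma f (A.symm : F →L[ℝ] E) ζ →
      ‖x - A'.symm (f x) - ζ‖ * (1 - 4 * u + 2 * u ^ 2) ≤ u * ‖x - ζ‖ := by
  set γ := smaleGamma f (A.symm : F →L[ℝ] E) ζ with hγd
  have hγ : 0 ≤ γ := gamma_nonneg _ _ _
  set h := x - ζ with hh
  have hxh : x = ζ + h := by rw [hh]; abel
  have hu0 : 0 ≤ ‖h‖ * γ := by positivity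
  obtain ⟨hu1, hpsi⟩ := hc _ hu0 hx
  -- choose a radius
  obtain ⟨r, hr1, hr2⟩ : ∃ r : ℝ, ‖h‖ < r ∧ r * γ < c := by
    have hcont : Tendsto (fun r : ℝ => r * γ) (𝓝[>] ‖h‖) (𝓝 (‖h‖ * γ)) :=
      ((continuous_id.mul continuous_const).tendsto' _ _ rfl).mono_left nhdsWithin_le_nhds
    have := (hcont.eventually_lt_const hx).and self_mem_nhdsWithin
    obtain ⟨r, h1, h2⟩ := this.exists
    exact ⟨r, h2, h1⟩
  have hr0 : 0 < r := (norm_nonneg _).trans_lt hr1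
  lift r to NNReal using hr0.le
  have hser := taylorQ_series D f hf (A.symm : F →L[ℝ] E) ζ hζ r (by exact_mod_cast hr0)
    (hc _ (by positivity) hr2).1.le (fun y hy => hball y (by
      rw [mem_ball, dist_eq_norm] at hy
      exact (mul_le_mul_of_nonneg_right hy.le hγ).trans_lt hr2))
  have hder : ∀ y ∈ D, fderiv ℝ (fun x => (A.symm : F →L[ℝ] E) (f x)) y
      = (A.symm : F →L[ℝ] E).comp (fderiv ℝ f y) := fun y hy =>
    ((A.symm : F →L[ℝ] E).hasFDerivAt.comp y (hf y hy).differentiableAt.hasFDerivAt).fderiv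
  have hid : fderiv ℝ (fun x => (A.symm : F →L[ℝ] E) (f x)) ζ = ContinuousLinearMap.id ℝ E := by
    rw [hder ζ hζ, ← hA]; ext v; simp
  obtain ⟨hb1, hb2⟩ := newton_est _ _ ζ r hser (by simp [hfζ]) hid γ hγ
    (taylorQ_bound f _ ζ (hf ζ hζ)) h (by
      rw [Metric.eball_coe, mem_ball_zero_iff]; exact hr1) hu1
  rw [← hxh, hder x (hball x hx)] at hb1 hb2
  generalize hu : ‖h‖ * γ = u at *
  set T : E →L[ℝ] E := ContinuousLinearMap.id ℝ E - (A.symm : F →L[ℝ] E).comp (fderiv ℝ f x) with hT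
  have hTn : ‖T‖ ≤ 1 / (1 - u) ^ 2 - 1 := by rw [hT, norm_sub_rev]; exact hb1
  have h1u : 0 < (1 - u) ^ 2 := by apply pow_pos; linarith
  have hT1 : ‖T‖ < 1 := by
    refine hTn.trans_lt ?_
    rw [sub_lt_iff_lt_add, div_lt_iff₀ h1u]; nlinarith
  let U : E ≃L[ℝ] E := ContinuousLinearEquiv.unitsEquiv ℝ E (Units.oneSub T hT1)
  have hU : ∀ v, U v = A.symm (fderiv ℝ f x v) := by
    intro v
    change (1 - T) v = _
    simp [hT]
  refine ⟨U.trans A, ?_, ?_⟩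
  · ext v; simp [hU]
  · intro v hv
    rw [hv]
    set w := x - (U.trans A).symm (f x) - ζ with hw
    have hUw : U w = (A.symm : F →L[ℝ] E).comp (fderiv ℝ f x) h - A.symm (f x) := by
      have : w = h - U.symm (A.symm (f x)) := by
        rw [hw, hh]; simp only [ContinuousLinearEquiv.symm_trans_apply]; abel
      rw [this, map_sub, U.apply_symm_apply, hU]; rfl
    have h3 : ‖U w‖ ≤ ‖h‖ * (u / (1 - u) ^ 2) := by rw [hUw]; exact hb2
    have h4 : ‖w‖ - ‖T‖ * ‖w‖ ≤ ‖U w‖ := by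
      have e : U w = w - T w := rfl
      rw [e]
      have := norm_sub_norm_le w (T w)
      have := T.le_opNorm w
      linarith
    have h5 : ‖w‖ * (2 - 1 / (1 - u) ^ 2) ≤ ‖h‖ * (u / (1 - u) ^ 2) := by
      have := mul_le_mul_of_nonneg_right hTn (norm_nonneg w)
      nlinarith
    have h6 := mul_le_mul_of_nonneg_right h5 h1u.le
    have hne : 1 - u ≠ 0 := (sub_pos.2 hu1).ne'
    have e1 : ‖w‖ * (2 - 1 / (1 - u) ^ 2) * (1 - u) ^ 2 = ‖w‖ * (1 - 4 * u + 2 * u ^ 2) := by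
      field_simp; ring
    have e2 : ‖h‖ * (u / (1 - u) ^ 2) * (1 - u) ^ 2 = u * ‖h‖ := by
      field_simp
    rwa [e1, e2] at h6

/-- Smale's gamma theorem: if `ζ` is a nondegenerate zero of the analytic map
`f` and the ball `B(ζ, (3-√7)/(2γ(f,ζ)))` is contained in `D` (expressed multiplicatively:
every `x` with `‖x - ζ‖·γ(f,ζ) < (3-√7)/2` lies in `D`), then every `x₀` in that ball is an
approximate zero of the first kind associated to `ζ`: the Newton sequence starting at `x₀` is
well-defined and `‖x_i - ζ‖ ≤ 2^(1-2^i)·‖x₀ - ζ‖` for all `i`. -/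
theorem stmt6 {E F : Type*} [NormedAddCommGroup E] [NormedSpace ℝ E] [CompleteSpace E]
    [NormedAddCommGroup F] [NormedSpace ℝ F] [CompleteSpace F]
    (D : Set E) (hD : IsOpen D) (f : E → F) (hf : AnalyticOnNhd ℝ f D)
    (ζ : E) (hζ : ζ ∈ D) (hfζ : f ζ = 0)
    (A : E ≃L[ℝ] F) (hA : (A : E →L[ℝ] F) = fderiv ℝ f ζ)
    (hball : ∀ x : E,
      ‖x - ζ‖ * smaleGamma f (A.symm : F →L[ℝ] E) ζ < (3 - Real.sqrt 7) / 2 → x ∈ D) :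
    ∀ x₀ : E, ‖x₀ - ζ‖ * smaleGamma f (A.symm : F →L[ℝ] E) ζ < (3 - Real.sqrt 7) / 2 →
      ∃ (xs : ℕ → E) (As : ℕ → E ≃L[ℝ] F), xs 0 = x₀ ∧
        ∀ i : ℕ, xs i ∈ D ∧ ((As i : E →L[ℝ] F) = fderiv ℝ f (xs i)) ∧
          xs (i + 1) = xs i - (As i).symm (f (xs i)) ∧
          ‖xs i - ζ‖ ≤ 2 ^ ((1 : ℤ) - 2 ^ i) * ‖x₀ - ζ‖ := by
  intro x₀ hx₀
  set γ := smaleGamma f (A.symm : F →L[ℝ] E) ζ with hγd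
  have hγ : 0 ≤ γ := gamma_nonneg _ _ _
  have hs : Real.sqrt 7 ^ 2 = 7 := Real.sq_sqrt (by norm_num)
  have hs0 : 0 ≤ Real.sqrt 7 := Real.sqrt_nonneg 7
  have hs2 : 2 < Real.sqrt 7 := by nlinarith
  have hs3 : Real.sqrt 7 < 3 := by nlinarith
  -- `2u ≤ ψ(u)` on the ball
  have hpsi : ∀ u : ℝ, 0 ≤ u → u < (3 - Real.sqrt 7) / 2 → 2 * u < 1 - 4 * u + 2 * u ^ 2 := by
    intro u hu0 hu
    nlinarith
  have hc : ∀ u : ℝ, 0 ≤ u → u < (3 - Real.sqrt 7) / 2 →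
      u < 1 ∧ 0 < 1 - 4 * u + 2 * u ^ 2 := by
    intro u hu0 hu
    exact ⟨by linarith, by linarith [hpsi u hu0 hu]⟩
  have step : ∀ x : E, ‖x - ζ‖ * γ < (3 - Real.sqrt 7) / 2 → _ := fun x hx =>
    newton_one D f hf ζ hζ hfζ A hA _ hc hball x hx
  have : Nonempty (E ≃L[ℝ] F) := ⟨A⟩
  classical
  choose! S hS1 hS2 using step
  let xs : ℕ → E := fun n => Nat.rec x₀ (fun _ x => x - (S x).symm (f x)) n
  have hxs : ∀ i, xs (i + 1) = xs i - (S (xs i)).symm (f (xs i)) := fun i => rfl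
  have hu0 : 0 ≤ ‖x₀ - ζ‖ * γ := by positivity
  have hpow : ∀ i : ℕ, (2:ℝ) ^ ((1:ℤ) - 2 ^ i) ≤ 1 := by
    intro i
    apply zpow_le_one_of_nonpos₀ (by norm_num)
    have : (1:ℤ) ≤ 2 ^ i := one_le_pow₀ (by norm_num)
    linarith
  have hmain : ∀ i, ‖xs i - ζ‖ ≤ 2 ^ ((1 : ℤ) - 2 ^ i) * ‖x₀ - ζ‖ := by
    intro i
    induction i with
    | zero => simp [xs]
    | succ i ih =>
      have hle : ‖xs i - ζ‖ ≤ ‖x₀ - ζ‖ :=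
        ih.trans (mul_le_of_le_one_left (norm_nonneg _) (hpow i))
      have hule : ‖xs i - ζ‖ * γ ≤ ‖x₀ - ζ‖ * γ := mul_le_mul_of_nonneg_right hle hγ
      have hb := hS2 (xs i) (hule.trans_lt hx₀) _ rfl
      rw [← hxs] at hb
      have hP := (hc _ hu0 hx₀).2
      have hP2 := hpsi _ hu0 hx₀
      have hu1 := (hc _ hu0 hx₀).1
      set e0 := ‖x₀ - ζ‖ with he0
      set ei := ‖xs i - ζ‖ with hei
      set t : ℝ := 2 ^ ((1:ℤ) - 2 ^ i) with ht
      have ht0 : 0 < t := by positivity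
      have hei0 : 0 ≤ ei := norm_nonneg _
      have he00 : 0 ≤ e0 := norm_nonneg _
      have hmono : 1 - 4 * (e0 * γ) + 2 * (e0 * γ) ^ 2 ≤ 1 - 4 * (ei * γ) + 2 * (ei * γ) ^ 2 := by
        have : 0 ≤ ei * γ := by positivity
        nlinarith
      have h1 : ‖xs (i + 1) - ζ‖ * (1 - 4 * (e0 * γ) + 2 * (e0 * γ) ^ 2) ≤ ei * γ * ei :=
        (mul_le_mul_of_nonneg_left hmono (norm_nonneg _)).trans hb
      have h2 : ei * γ * ei ≤ (t * e0) * γ * (t * e0) := by gcongr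
      have h3 : (t * e0) * γ * (t * e0) ≤ (t * t / 2 * e0) *
          (1 - 4 * (e0 * γ) + 2 * (e0 * γ) ^ 2) := by
        have := mul_le_mul_of_nonneg_left hP2.le (by positivity : 0 ≤ t * t / 2 * e0)
        linarith
      have h4 := le_of_mul_le_mul_right (h1.trans (h2.trans h3)) hP
      have e : (2:ℝ) ^ ((1:ℤ) - 2 ^ (i + 1)) = t * t / 2 := by
        rw [ht, ← zpow_add₀ (by norm_num), div_eq_mul_inv, ← zpow_sub_one₀ (by norm_num)]
        congr 1; ring
      rw [e]; exact h4
  have hin : ∀ i, ‖xs i - ζ‖ * γ < (3 - Real.sqrt 7) / 2 := fun i =>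
    (mul_le_mul_of_nonneg_right ((hmain i).trans
      (mul_le_of_le_one_left (norm_nonneg _) (hpow i))) hγ).trans_lt hx₀
  exact ⟨xs, fun i => S (xs i), rfl, fun i =>
    ⟨hball _ (hin i), hS1 _ (hin i), hxs i, hmain i⟩⟩
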